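/- arXiv:1901.02625 — 3 statements merged into one kernel-verified Lean document; each statement's English description precedes it below -/
import Mathlib

section
/- Let p be a prime, n ≥ 1, and let g₁, g₂ be n×n matrices over ℤ_p with nonzero determinant. Then for every ℤ_pⁿ-periodic function f : ℚ_pⁿ → ℂ, the function π(g₂)f is again ℤ_pⁿ-periodic, and π(g₁)(π(g₂)f) = π(g₁g₂)f. -/
open scoped BigOperators

/-- The additive subgroup `ℤ_pⁿ` of `ℚ_pⁿ`. -/
noncomputable def Zlat (p : ℕ) [Fact p.Prime] (n : ℕ) : AddSubgroup (Fin n → ℚ_[p]) :=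
  AddSubgroup.pi Set.univ fun _ => (PadicInt.subring p).toAddSubgroup

/-- The image of `g⁻¹ℤ_pⁿ = {x : ℚ_pⁿ | gx ∈ ℤ_pⁿ}` in the quotient group `ℚ_pⁿ/ℤ_pⁿ`,
i.e. the finite group `g⁻¹ℤ_pⁿ/ℤ_pⁿ`. -/
noncomputable def cosets (p : ℕ) [Fact p.Prime] (n : ℕ) (g : Matrix (Fin n) (Fin n) ℤ_[p]) :
    Set ((Fin n → ℚ_[p]) ⧸ Zlat p n) :=
  (AddSubgroup.map (QuotientAddGroup.mk' (Zlat p n))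
    (AddSubgroup.comap
      (Matrix.mulVecLin (g.map (fun a => (a : ℚ_[p])))).toAddMonoidHom (Zlat p n)) : Set _)

/-- The operator `π(g)` : `(π(g)f)(x) = Σ_{r ∈ g⁻¹ℤ_pⁿ/ℤ_pⁿ} f(g⁻¹x + r)`, each coset being
evaluated at a representative (for `ℤ_pⁿ`-periodic `f` the value does not depend on the
choice of representative). -/
noncomputable def piOp (p : ℕ) [Fact p.Prime] (n : ℕ) (g : Matrix (Fin n) (Fin n) ℤ_[p])
    (f : (Fin n → ℚ_[p]) → ℂ) : (Fin n → ℚ_[p]) → ℂ :=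
  fun x => ∑ᶠ r ∈ cosets p n g,
    f ((g.map (fun a => (a : ℚ_[p])))⁻¹.mulVec x + Quotient.out r)

/-- A matrix over `ℤ_p`, viewed as a matrix over `ℚ_p`. -/
noncomputable abbrev padicMatrix {p : ℕ} [Fact p.Prime] {n : ℕ}
    (g : Matrix (Fin n) (Fin n) ℤ_[p]) : Matrix (Fin n) (Fin n) ℚ_[p] :=
  g.map (fun a => (a : ℚ_[p]))

section

variable {p : ℕ} [Fact p.Prime] {n : ℕ}

lemma mem_Zlat {x : Fin n → ℚ_[p]} : x ∈ Zlat p n ↔ ∃ y : Fin n → ℤ_[p], ∀ i, x i = y i := by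
  have h : x ∈ Zlat p n ↔ ∀ i, ‖x i‖ ≤ 1 := by
    simp [Zlat, AddSubgroup.mem_pi]
  rw [h]
  refine ⟨fun hx => ⟨fun i => ⟨x i, hx i⟩, fun i => rfl⟩, ?_⟩
  rintro ⟨y, hy⟩ i
  rw [hy]
  exact (y i).2

lemma padicMatrix_mulVec_mem (g : Matrix (Fin n) (Fin n) ℤ_[p]) {x : Fin n → ℚ_[p]}
    (hx : x ∈ Zlat p n) : (padicMatrix g).mulVec x ∈ Zlat p n := by
  obtain ⟨y, hy⟩ := mem_Zlat.1 hx
  refine mem_Zlat.2 ⟨g.mulVec y, fun i => ?_⟩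
  simp [Matrix.mulVec, dotProduct, hy, PadicInt.coe_sum]

lemma padicMatrix_det (g : Matrix (Fin n) (Fin n) ℤ_[p]) :
    (padicMatrix g).det = (g.det : ℚ_[p]) :=
  (RingHom.map_det PadicInt.Coe.ringHom g).symm

lemma padicMatrix_adjugate (g : Matrix (Fin n) (Fin n) ℤ_[p]) :
    (padicMatrix g).adjugate = padicMatrix g.adjugate :=
  (RingHom.map_adjugate PadicInt.Coe.ringHom g).symm

lemma padicMatrix_mul (g h : Matrix (Fin n) (Fin n) ℤ_[p]) :
    padicMatrix (g * h) = padicMatrix g * padicMatrix h :=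
  Matrix.map_mul (f := PadicInt.Coe.ringHom)

lemma isUnit_det_padicMatrix {g : Matrix (Fin n) (Fin n) ℤ_[p]} (hg : g.det ≠ 0) :
    IsUnit (padicMatrix g).det := by
  rw [padicMatrix_det, isUnit_iff_ne_zero]
  simpa using hg

/-- The endomorphism of `ℚ_pⁿ/ℤ_pⁿ` induced by a matrix over `ℤ_p`. -/
noncomputable def quotMulVec (g : Matrix (Fin n) (Fin n) ℤ_[p]) :
    ((Fin n → ℚ_[p]) ⧸ Zlat p n) →+ ((Fin n → ℚ_[p]) ⧸ Zlat p n) :=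
  QuotientAddGroup.map _ _ (Matrix.mulVecLin (padicMatrix g)).toAddMonoidHom
    fun _ hx => padicMatrix_mulVec_mem g hx

lemma quotMulVec_mk (g : Matrix (Fin n) (Fin n) ℤ_[p]) (x : Fin n → ℚ_[p]) :
    quotMulVec g (x : (Fin n → ℚ_[p]) ⧸ Zlat p n) = ((padicMatrix g).mulVec x : _ ⧸ Zlat p n) :=
  rfl

lemma quotMulVec_mul (g h : Matrix (Fin n) (Fin n) ℤ_[p]) (q : (Fin n → ℚ_[p]) ⧸ Zlat p n) :
    quotMulVec (g * h) q = quotMulVec g (quotMulVec h q) := by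
  induction q using QuotientAddGroup.induction_on with
  | H x => simp only [quotMulVec_mk, padicMatrix_mul, Matrix.mulVec_mulVec]

lemma mem_cosets {g : Matrix (Fin n) (Fin n) ℤ_[p]} {q : (Fin n → ℚ_[p]) ⧸ Zlat p n} :
    q ∈ cosets p n g ↔ quotMulVec g q = 0 := by
  induction q using QuotientAddGroup.induction_on with
  | H x =>
    rw [quotMulVec_mk, QuotientAddGroup.eq_zero_iff]
    constructor
    · rintro ⟨y, hy, hxy⟩
      have hyx : -y + x ∈ Zlat p n := QuotientAddGroup.eq.1 hxy
      have h := add_mem (show (padicMatrix g).mulVec y ∈ Zlat p n from hy)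
        (padicMatrix_mulVec_mem g hyx)
      rwa [← Matrix.mulVec_add, add_neg_cancel_left] at h
    · exact fun hx => ⟨x, hx, rfl⟩

lemma finite_cosets {g : Matrix (Fin n) (Fin n) ℤ_[p]} (hg : g.det ≠ 0) :
    (cosets p n g).Finite := by
  set d : ℚ_[p] := (g.det : ℚ_[p]) with hd
  have hd0 : d ≠ 0 := by simpa [hd] using hg
  set k := g.det.valuation with hk
  refine (Set.finite_range fun a : Fin n → Fin (p ^ k) =>
    ((fun i => d⁻¹ * ((a i : ℕ) : ℚ_[p]) : Fin n → ℚ_[p]) : _ ⧸ Zlat p n)).subset ?_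
  intro q hq
  rw [mem_cosets] at hq
  induction q using QuotientAddGroup.induction_on with
  | H x =>
    rw [quotMulVec_mk, QuotientAddGroup.eq_zero_iff] at hq
    have hadj := padicMatrix_mulVec_mem g.adjugate hq
    rw [← padicMatrix_adjugate, Matrix.mulVec_mulVec, Matrix.adjugate_mul, padicMatrix_det,
      Matrix.smul_mulVec, Matrix.one_mulVec] at hadj
    obtain ⟨y, hy⟩ := mem_Zlat.1 hadj
    refine ⟨fun i => ⟨(y i).appr k, PadicInt.appr_lt _ _⟩, QuotientAddGroup.eq.2 ?_⟩
    have hdvd : ∀ i, ∃ z : ℤ_[p], y i - (y i).appr k = g.det * z := by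
      intro i
      obtain ⟨z, hz⟩ := Ideal.mem_span_singleton.1 (PadicInt.appr_spec k (y i))
      refine ⟨((PadicInt.unitCoeff hg)⁻¹ : ℤ_[p]ˣ) * z, ?_⟩
      nth_rewrite 1 [PadicInt.unitCoeff_spec hg]
      rw [hz, ← hk]
      linear_combination (-(p : ℤ_[p]) ^ k * z) * (PadicInt.unitCoeff hg).mul_inv
    choose z hz using hdvd
    refine mem_Zlat.2 ⟨z, fun i => ?_⟩
    have h1 : d * x i = y i := by simpa using hy i
    have h2 : (y i : ℚ_[p]) - ((y i).appr k : ℕ) = d * z i := by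
      have := congrArg (fun a : ℤ_[p] => (a : ℚ_[p])) (hz i)
      simpa using this
    simp only [Pi.add_apply, Pi.neg_apply]
    field_simp
    linear_combination h1 + h2

variable {f : (Fin n → ℚ_[p]) → ℂ}

lemma periodic_out_eq (hf : ∀ x r, r ∈ Zlat p n → f (x + r) = f x) {x : Fin n → ℚ_[p]}
    {q : (Fin n → ℚ_[p]) ⧸ Zlat p n} (h : (x : _ ⧸ Zlat p n) = q) : f (Quotient.out q) = f x := by
  have h' : -x + Quotient.out q ∈ Zlat p n :=
    QuotientAddGroup.eq.1 (h.trans (QuotientAddGroup.out_eq' q).symm)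
  simpa using hf x _ h'

lemma bijOn_cosets_fiber {g : Matrix (Fin n) (Fin n) ℤ_[p]} (hg : g.det ≠ 0)
    (x : Fin n → ℚ_[p]) :
    Set.BijOn (fun r => (((padicMatrix g)⁻¹.mulVec x : Fin n → ℚ_[p]) : _ ⧸ Zlat p n) + r)
      (cosets p n g) {q | quotMulVec g q = x} := by
  have hx : quotMulVec g (((padicMatrix g)⁻¹.mulVec x : Fin n → ℚ_[p]) : _ ⧸ Zlat p n) = x := by
    rw [quotMulVec_mk, Matrix.mulVec_mulVec, Matrix.mul_nonsing_inv _ (isUnit_det_padicMatrix hg),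
      Matrix.one_mulVec]
  refine ⟨fun r hr => ?_, (add_right_injective _).injOn, fun q hq => ?_⟩
  · simp only [Set.mem_ofPred_eq, map_add, hx, mem_cosets.1 hr, add_zero]
  · refine ⟨-(((padicMatrix g)⁻¹.mulVec x : Fin n → ℚ_[p]) : _ ⧸ Zlat p n) + q, ?_,
      add_neg_cancel_left _ _⟩
    rw [mem_cosets, map_add, map_neg, hx, show quotMulVec g q = x from hq, neg_add_cancel]

lemma finite_fiber {g : Matrix (Fin n) (Fin n) ℤ_[p]} (hg : g.det ≠ 0)
    (q : (Fin n → ℚ_[p]) ⧸ Zlat p n) : {r | quotMulVec g r = q}.Finite := by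
  induction q using QuotientAddGroup.induction_on with
  | H x =>
    rw [← (bijOn_cosets_fiber hg x).image_eq]
    exact (finite_cosets hg).image _

/-- On periodic functions, `π(g)` is summation over the fibres of the endomorphism of
`ℚ_pⁿ/ℤ_pⁿ` induced by `g`. -/
lemma piOp_eq_finsum_fiber {g : Matrix (Fin n) (Fin n) ℤ_[p]} (hg : g.det ≠ 0)
    (hf : ∀ x r, r ∈ Zlat p n → f (x + r) = f x) (x : Fin n → ℚ_[p]) :
    piOp p n g f x = ∑ᶠ q ∈ {q | quotMulVec g q = x}, f (Quotient.out q) := by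
  refine finsum_mem_eq_of_bijOn _ (bijOn_cosets_fiber hg x) fun r _ => ?_
  refine (periodic_out_eq hf ?_).symm
  rw [QuotientAddGroup.mk_add]
  congr 1
  exact QuotientAddGroup.out_eq' r

lemma piOp_periodic {g : Matrix (Fin n) (Fin n) ℤ_[p]} (hg : g.det ≠ 0)
    (hf : ∀ x r, r ∈ Zlat p n → f (x + r) = f x) (x r : Fin n → ℚ_[p]) (hr : r ∈ Zlat p n) :
    piOp p n g f (x + r) = piOp p n g f x := by
  rw [piOp_eq_finsum_fiber hg hf, piOp_eq_finsum_fiber hg hf,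
    QuotientAddGroup.mk_add_of_mem x hr]

end

theorem piOp_periodic_and_mul (p : ℕ) [Fact p.Prime] (n : ℕ) (hn : 1 ≤ n)
    (g₁ g₂ : Matrix (Fin n) (Fin n) ℤ_[p]) (hg₁ : g₁.det ≠ 0) (hg₂ : g₂.det ≠ 0)
    (f : (Fin n → ℚ_[p]) → ℂ) (hf : ∀ x r, r ∈ Zlat p n → f (x + r) = f x) :
    (∀ x r, r ∈ Zlat p n → piOp p n g₂ f (x + r) = piOp p n g₂ f x) ∧
      piOp p n g₁ (piOp p n g₂ f) = piOp p n (g₁ * g₂) f := by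
  refine ⟨piOp_periodic hg₂ hf, funext fun x => ?_⟩
  have hg : (g₁ * g₂).det ≠ 0 := by
    rw [Matrix.det_mul]
    exact mul_ne_zero hg₁ hg₂
  have hfib : {q | quotMulVec (g₁ * g₂) q = (x : _ ⧸ Zlat p n)} =
      ⋃ r ∈ {r | quotMulVec g₁ r = (x : _ ⧸ Zlat p n)}, {q | quotMulVec g₂ q = r} := by
    ext q
    simp [quotMulVec_mul]
  rw [piOp_eq_finsum_fiber hg₁ (piOp_periodic hg₂ hf), piOp_eq_finsum_fiber hg hf, hfib,
    finsum_mem_biUnion _ (finite_fiber hg₁ _) fun r _ => finite_fiber hg₂ r]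
  · refine finsum_mem_congr rfl fun r _ => ?_
    rw [piOp_eq_finsum_fiber hg₂ hf,
      show ((Quotient.out r : Fin n → ℚ_[p]) : _ ⧸ Zlat p n) = r from QuotientAddGroup.out_eq' r]
  · intro r _ s _ hrs
    exact Set.disjoint_left.2 fun q hr hs => hrs (hr.symm.trans hs)
end

section
/- Let g be an n×n matrix with entries in R = ℝ[[t]] such that det g ≠ 0, and write det g = t^N (c₀ + c₁ t + …) with c₀ ≠ 0 (i.e. N is the t-adic order of det g). Then the quotient Rⁿ/gRⁿ, where gRⁿ is the image of the map x ↦ gx on Rⁿ, is a finite-dimensional real vector space of dimension exactly N: dim_ℝ (Rⁿ/gRⁿ) = N. -/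
open Module PowerSeries in
/-- The quotient of `K⟦X⟧` by `X ^ k` is identified with `K ^ k` by the first `k` coefficients. -/
noncomputable def PowerSeries.quotientSpanXPowEquiv (K : Type*) [Field K] (k : ℕ) :
    (PowerSeries K ⧸ Ideal.span {(X : PowerSeries K) ^ k}) ≃ₗ[K] (Fin k → K) :=
  let φ : PowerSeries K →ₗ[K] (Fin k → K) := LinearMap.pi fun i => coeff (i : ℕ)
  have hker : (Ideal.span {(X : PowerSeries K) ^ k}).restrictScalars K = LinearMap.ker φ := by
    ext f
    simp [φ, Ideal.mem_span_singleton, X_pow_dvd_iff, funext_iff, Fin.forall_iff]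
  have hsurj : Function.Surjective φ := fun v =>
    ⟨mk fun m => if h : m < k then v ⟨m, h⟩ else 0, by ext i; simp [φ]⟩
  (Submodule.Quotient.restrictScalarsEquiv K (Ideal.span {(X : PowerSeries K) ^ k})).symm ≪≫ₗ
    Submodule.quotEquivOfEq _ _ hker ≪≫ₗ φ.quotKerEquivOfSurjective hsurj

open PowerSeries in
theorem PowerSeries.associated_X_pow_order {K : Type*} [Field K] {a : PowerSeries K}
    (ha : a ≠ 0) : Associated a (X ^ a.order.toNat) := by
  refine Associated.symm ⟨Unit_of_divided_by_X_pow_order a, ?_⟩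
  rw [Unit_of_divided_by_X_pow_order_nonzero ha, X_pow_order_mul_divXPowOrder]

theorem PowerSeries.finite_quotient_span_singleton {K : Type*} [Field K] {a : PowerSeries K}
    (ha : a ≠ 0) : Module.Finite K (PowerSeries K ⧸ Ideal.span {a}) := by
  rw [Ideal.span_singleton_eq_span_singleton.mpr (associated_X_pow_order ha)]
  exact Module.Finite.equiv (quotientSpanXPowEquiv K _).symm

theorem PowerSeries.finrank_quotient_span_singleton {K : Type*} [Field K] {a : PowerSeries K}
    (ha : a ≠ 0) : Module.finrank K (PowerSeries K ⧸ Ideal.span {a}) = a.order.toNat := by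
  rw [Ideal.span_singleton_eq_span_singleton.mpr (associated_X_pow_order ha),
    (quotientSpanXPowEquiv K _).finrank_eq, Module.finrank_fin_fun]

theorem PowerSeries.order_eq_of_associated {K : Type*} [Field K] {a b : PowerSeries K}
    (h : Associated a b) : a.order = b.order := by
  obtain ⟨u, rfl⟩ := h
  rw [order_mul, order_zero_of_unit u.isUnit, add_zero]

/-- The determinant of an injective endomorphism of a free module over a principal ideal domain is
associated to the product of the Smith coefficients of its range. -/
theorem LinearMap.associated_det_prod_smithNormalFormCoeffs {R M ι : Type*} [CommRing R]
    [IsDomain R] [IsPrincipalIdealRing R] [AddCommGroup M] [Module R M] [Fintype ι]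
    (b : Module.Basis ι R M) (f : M →ₗ[R] M) (hf : Function.Injective f)
    (h : Module.finrank R (LinearMap.range f) = Module.finrank R M) :
    Associated (LinearMap.det f) (∏ i, Submodule.smithNormalFormCoeffs b h i) := by
  classical
  let b' := Submodule.smithNormalFormTopBasis b h
  let e : M ≃ₗ[R] M := (b'.equiv (Submodule.smithNormalFormBotBasis b h) (Equiv.refl _)).trans
    (LinearEquiv.ofInjective f hf).symm
  rw [← Matrix.det_diagonal, ← LinearMap.det_toLin b']
  refine (LinearMap.associated_det_of_eq_comp e _ _ fun x => ?_).symm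
  suffices Matrix.toLin b' b' (Matrix.diagonal (Submodule.smithNormalFormCoeffs b h)) =
      f ∘ₗ e.toLinearMap from LinearMap.congr_fun this x
  refine b'.ext fun i => ?_
  have key (y : LinearMap.range f) : f ((LinearEquiv.ofInjective f hf).symm y) = y :=
    congrArg Subtype.val ((LinearEquiv.ofInjective f hf).apply_symm_apply y)
  simp [e, key, b', Submodule.smithNormalFormBotBasis_def, Matrix.toLin_self, Matrix.diagonal_apply]

theorem PowerSeries.order_prod_eq_sum_toNat {K ι : Type*} [Field K] (s : Finset ι)
    (a : ι → PowerSeries K) (ha : ∀ i ∈ s, a i ≠ 0) :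
    (∏ i ∈ s, a i).order = ((∑ i ∈ s, (a i).order.toNat : ℕ) : ℕ∞) := by
  rw [order_prod, Nat.cast_sum]
  exact Finset.sum_congr rfl fun i hi => (ENat.natCast_toNat (order_eq_top.not.mpr (ha i hi))).symm

theorem powerSeries_quotient_finrank (n : ℕ)
    (g : Matrix (Fin n) (Fin n) (PowerSeries ℝ)) (hg : g.det ≠ 0)
    (N : ℕ) (hN : g.det.order = N) :
    Module.finrank ℝ
      ((Fin n → PowerSeries ℝ) ⧸ LinearMap.range (Matrix.mulVecLin g)) = N := by
  have hinj : Function.Injective g.mulVecLin := Matrix.mulVec_injective_of_det_ne_zero hg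
  have hrank := LinearMap.finrank_range_of_inj hinj
  let b := Pi.basisFun (PowerSeries ℝ) (Fin n)
  have ha (i : Fin n) := Submodule.smithNormalFormCoeffs_ne_zero b hrank i
  have hfin (i : Fin n) := PowerSeries.finite_quotient_span_singleton (ha i)
  have hdet := LinearMap.associated_det_prod_smithNormalFormCoeffs b g.mulVecLin hinj hrank
  rw [Submodule.finrank_quotient_eq_sum ℝ b hrank,
    Finset.sum_congr rfl fun i _ => PowerSeries.finrank_quotient_span_singleton (ha i)]
  rw [← LinearMap.det_toLin' g, Matrix.toLin'_apply', PowerSeries.order_eq_of_associated hdet,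
    PowerSeries.order_prod_eq_sum_toNat _ _ fun i _ => ha i] at hN
  exact_mod_cast hN
end

section
/- Let c₁, c₂, u₁, u₂, w ∈ ℝ and let u be the upper triangular unipotent 3×3 real matrix with rows (1, u₁, w), (0, 1, u₂), (0, 0, 1). Then for every Schwartz function f on the space M₃(ℝ) of 3×3 real matrices, ∫_{ℝ⁸} f(uX) e^{2πi(c₁ x₁₁/x₂₁ + c₂ x₂₂/x₃₂)} dX = e^{-2πi(c₁u₁ + c₂u₂)} ∫_{ℝ⁸} f(X) e^{2πi(c₁ x₁₁/x₂₁ + c₂ x₂₂/x₃₂)} dX, where X runs over the 3×3 real matrices with entry x₃₁ = 0, and dX is Lebesgue measure in the remaining eight entries x₁₁, x₁₂, x₁₃, x₂₁, x₂₂, x₂₃, x₃₂, x₃₃ (both integrands are absolutely integrable, the phase being defined off the null set where x₂₁ = 0 or x₃₂ = 0). -/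
open MeasureTheory

/-- The 3×3 matrix with `x₃₁ = 0` built from the eight free coordinates
`x₁₁, x₁₂, x₁₃, x₂₁, x₂₂, x₂₃, x₃₂, x₃₃`. -/
def Xof (y : Fin 8 → ℝ) : Matrix (Fin 3) (Fin 3) ℝ :=
  !![y 0, y 1, y 2; y 3, y 4, y 5; 0, y 6, y 7]

/-- The phase `e^{2πi(c₁ x₁₁/x₂₁ + c₂ x₂₂/x₃₂)}`. -/
noncomputable def phase13 (c₁ c₂ : ℝ) (y : Fin 8 → ℝ) : ℂ :=
  Complex.exp (2 * Real.pi * Complex.I * ((c₁ : ℂ) * ((y 0 : ℝ) / y 3 : ℝ)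
    + (c₂ : ℂ) * ((y 4 : ℝ) / y 6 : ℝ)))

/-- `Xof` as a continuous linear map. -/
noncomputable def XofCLM : (Fin 8 → ℝ) →L[ℝ] (Fin 3 → Fin 3 → ℝ) :=
  LinearMap.toContinuousLinearMap
    { toFun := fun y i j => Xof y i j
      map_add' := by
        intro x y
        ext i j
        fin_cases i <;> fin_cases j <;> simp [Xof]
      map_smul' := by
        intro c y
        ext i j
        fin_cases i <;> fin_cases j <;> simp [Xof] }

theorem norm_le_norm_XofCLM (y : Fin 8 → ℝ) : ‖y‖ ≤ ‖XofCLM y‖ := by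
  have entry (i j : Fin 3) : |Xof y i j| ≤ ‖XofCLM y‖ :=
    (norm_le_pi_norm (XofCLM y i) j).trans (norm_le_pi_norm (XofCLM y) i)
  refine (pi_norm_le_iff_of_nonneg (norm_nonneg _)).2 fun k => ?_
  fin_cases k
  · exact entry 0 0
  · exact entry 0 1
  · exact entry 0 2
  · exact entry 1 0
  · exact entry 1 1
  · exact entry 1 2
  · exact entry 2 1
  · exact entry 2 2

theorem SchwartzMap.integrable_comp_Xof (f : SchwartzMap (Fin 3 → Fin 3 → ℝ) ℂ) :
    Integrable (fun y : Fin 8 → ℝ => f (fun i j => Xof y i j)) := by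
  have hbound : ∃ (k : ℕ) (C : ℝ), ∀ y, ‖y‖ ≤ C * (1 + ‖XofCLM y‖) ^ k :=
    ⟨1, 1, fun y => by linarith [norm_le_norm_XofCLM y]⟩
  exact (SchwartzMap.compCLM ℝ XofCLM.hasTemperateGrowth hbound f).integrable

theorem measurable_phase13 (c₁ c₂ : ℝ) : Measurable (phase13 c₁ c₂) := by
  unfold phase13
  fun_prop

theorem norm_phase13 (c₁ c₂ : ℝ) (y : Fin 8 → ℝ) : ‖phase13 c₁ c₂ y‖ = 1 := by
  rw [phase13, ← Complex.norm_exp_ofReal_mul_I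
    (2 * Real.pi * (c₁ * (y 0 / y 3) + c₂ * (y 4 / y 6)))]
  congr 2
  push_cast
  ring

/-- The matrix, in the coordinates of `Xof`, of left multiplication by the upper triangular
unipotent matrix with entries `u₁, u₂, w`. -/
def unipotentAction (u₁ u₂ w : ℝ) : Matrix (Fin 8) (Fin 8) ℝ :=
  !![1, 0, 0, u₁, 0, 0, 0, 0;
     0, 1, 0, 0, u₁, 0, w, 0;
     0, 0, 1, 0, 0, u₁, 0, w;
     0, 0, 0, 1, 0, 0, 0, 0;
     0, 0, 0, 0, 1, 0, u₂, 0;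
     0, 0, 0, 0, 0, 1, 0, u₂;
     0, 0, 0, 0, 0, 0, 1, 0;
     0, 0, 0, 0, 0, 0, 0, 1]

theorem det_unipotentAction (u₁ u₂ w : ℝ) : (unipotentAction u₁ u₂ w).det = 1 := by
  rw [Matrix.det_of_isUpperTriangular]
  · simp [Fin.prod_univ_succ, unipotentAction]
  · intro i j hij
    fin_cases i <;> fin_cases j <;> first | rfl | exact absurd hij (by decide)

theorem measurePreserving_unipotentAction (u₁ u₂ w : ℝ) :
    MeasurePreserving (Matrix.toLin' (unipotentAction u₁ u₂ w)) := by
  refine ⟨(LinearMap.continuous_of_finiteDimensional _).measurable, ?_⟩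
  rw [Real.map_matrix_volume_pi_eq_smul_volume_pi (by simp [det_unipotentAction])]
  simp [det_unipotentAction]

theorem toLin'_unipotentAction_apply (u₁ u₂ w : ℝ) (y : Fin 8 → ℝ) :
    Matrix.toLin' (unipotentAction u₁ u₂ w) y =
      ![y 0 + u₁ * y 3, y 1 + u₁ * y 4 + w * y 6, y 2 + u₁ * y 5 + w * y 7, y 3,
        y 4 + u₂ * y 6, y 5 + u₂ * y 7, y 6, y 7] := by
  ext k
  fin_cases k <;>
    simp [unipotentAction, Matrix.mulVec, dotProduct, Fin.sum_univ_succ, add_assoc]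

theorem Xof_unipotentAction (u₁ u₂ w : ℝ) (y : Fin 8 → ℝ) :
    Xof (Matrix.toLin' (unipotentAction u₁ u₂ w) y) =
      (!![1, u₁, w; 0, 1, u₂; 0, 0, 1] : Matrix (Fin 3) (Fin 3) ℝ) * Xof y := by
  rw [toLin'_unipotentAction_apply]
  ext i j
  fin_cases i <;> fin_cases j <;> simp [Xof, Matrix.mul_apply, Fin.sum_univ_succ] <;> ring

theorem phase13_unipotentAction (c₁ c₂ u₁ u₂ w : ℝ) {y : Fin 8 → ℝ} (h₃ : y 3 ≠ 0)
    (h₆ : y 6 ≠ 0) :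
    phase13 c₁ c₂ y =
      Complex.exp (-(2 * Real.pi * Complex.I) * ((c₁ : ℂ) * u₁ + (c₂ : ℂ) * u₂)) *
        phase13 c₁ c₂ (Matrix.toLin' (unipotentAction u₁ u₂ w) y) := by
  rw [toLin'_unipotentAction_apply, phase13, phase13, ← Complex.exp_add]
  have e₁ : (y 0 + u₁ * y 3) / y 3 = y 0 / y 3 + u₁ := by field_simp
  have e₂ : (y 4 + u₂ * y 6) / y 6 = y 4 / y 6 + u₂ := by field_simp
  congr 1
  change _ = _ + 2 * Real.pi * Complex.I * ((c₁ : ℂ) * ((y 0 + u₁ * y 3) / y 3 : ℝ)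
    + (c₂ : ℂ) * ((y 4 + u₂ * y 6) / y 6 : ℝ))
  rw [e₁, e₂]
  push_cast
  ring

theorem whittaker_functional_GL3_left (c₁ c₂ u₁ u₂ w : ℝ)
    (f : SchwartzMap (Fin 3 → Fin 3 → ℝ) ℂ) :
    Integrable (fun y : Fin 8 → ℝ =>
      f (fun i j => ((!![1, u₁, w; 0, 1, u₂; 0, 0, 1] : Matrix (Fin 3) (Fin 3) ℝ)
        * Xof y) i j) * phase13 c₁ c₂ y) ∧
    Integrable (fun y : Fin 8 → ℝ => f (fun i j => Xof y i j) * phase13 c₁ c₂ y) ∧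
    (∫ y : Fin 8 → ℝ,
        f (fun i j => ((!![1, u₁, w; 0, 1, u₂; 0, 0, 1] : Matrix (Fin 3) (Fin 3) ℝ)
          * Xof y) i j) * phase13 c₁ c₂ y)
      = Complex.exp (-(2 * Real.pi * Complex.I) * ((c₁ : ℂ) * u₁ + (c₂ : ℂ) * u₂))
          * ∫ y : Fin 8 → ℝ, f (fun i j => Xof y i j) * phase13 c₁ c₂ y := by
  have hint : Integrable (fun y : Fin 8 → ℝ => f (fun i j => Xof y i j) * phase13 c₁ c₂ y) :=
    f.integrable_comp_Xof.mul_bdd (measurable_phase13 c₁ c₂).aestronglyMeasurable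
      (Filter.Eventually.of_forall fun y => (norm_phase13 c₁ c₂ y).le)
  have hT := measurePreserving_unipotentAction u₁ u₂ w
  have hae : (fun y : Fin 8 → ℝ =>
      f (fun i j => ((!![1, u₁, w; 0, 1, u₂; 0, 0, 1] : Matrix (Fin 3) (Fin 3) ℝ)
        * Xof y) i j) * phase13 c₁ c₂ y) =ᵐ[volume] fun y =>
      Complex.exp (-(2 * Real.pi * Complex.I) * ((c₁ : ℂ) * u₁ + (c₂ : ℂ) * u₂)) *
        ((fun y : Fin 8 → ℝ => f (fun i j => Xof y i j) * phase13 c₁ c₂ y) ∘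
          Matrix.toLin' (unipotentAction u₁ u₂ w)) y := by
    filter_upwards [Measure.ae_eval_ne (fun _ : Fin 8 => (volume : Measure ℝ)) 3 0,
      Measure.ae_eval_ne (fun _ : Fin 8 => (volume : Measure ℝ)) 6 0] with y h₃ h₆
    rw [Function.comp_apply, Xof_unipotentAction, phase13_unipotentAction c₁ c₂ u₁ u₂ w h₃ h₆]
    ring
  refine ⟨((hT.integrable_comp_of_integrable hint).const_mul _).congr hae.symm, hint, ?_⟩
  rw [integral_congr_ae hae, integral_const_mul]
  congr 1
  have hmap := integral_map hT.measurable.aemeasurable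
    (hT.map_eq.symm ▸ hint.aestronglyMeasurable)
  rw [hT.map_eq] at hmap
  exact hmap.symm
end
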